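/- arXiv:1802.01610 — 2 statements merged into one kernel-verified Lean document; each statement's English description precedes it below -/
import Mathlib

section
/- The function a ↦ log(a) − ψ(a) tends to 0 as a → ∞, where ψ(a) = d/da log Γ(a) is the digamma function and Γ is the real Gamma function. -/
namespace Real

lemma differentiableAt_log_Gamma {x : ℝ} (hx : 0 < x) :
    DifferentiableAt ℝ (fun y : ℝ => log (Gamma y)) x :=
  (differentiableAt_Gamma fun m ↦ ((neg_nonpos.mpr m.cast_nonneg).trans_lt hx).ne').log
    (Gamma_pos_of_pos hx).ne'

lemma slope_log_Gamma_add_one {x : ℝ} (hx : 0 < x) :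
    slope (fun y : ℝ => log (Gamma y)) x (x + 1) = log x := by
  rw [slope_def_field, Gamma_add_one hx.ne', log_mul hx.ne' (Gamma_pos_of_pos hx).ne']
  ring

lemma deriv_log_Gamma_le_log {x : ℝ} (hx : 0 < x) :
    deriv (fun y : ℝ => log (Gamma y)) x ≤ log x := by
  rw [← slope_log_Gamma_add_one hx]
  exact convexOn_log_Gamma.deriv_le_slope hx (hx.trans (lt_add_one x)) (lt_add_one x)
    (differentiableAt_log_Gamma hx)

lemma log_le_deriv_log_Gamma_add_one {x : ℝ} (hx : 0 < x) :
    log x ≤ deriv (fun y : ℝ => log (Gamma y)) (x + 1) := by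
  have hx' : 0 < x + 1 := hx.trans (lt_add_one x)
  rw [← slope_log_Gamma_add_one hx]
  exact convexOn_log_Gamma.slope_le_deriv hx hx' (lt_add_one x) (differentiableAt_log_Gamma hx')

end Real

/-- The function a ↦ log a − ψ(a) tends to 0 as a → ∞, where ψ = (log Γ)′. -/
theorem log_sub_digamma_tendsto_zero :
    Filter.Tendsto
      (fun a : ℝ => Real.log a - deriv (fun x : ℝ => Real.log (Real.Gamma x)) a)
      Filter.atTop (nhds 0) := by
  have hlim : Filter.Tendsto (fun a : ℝ => (a - 1)⁻¹) Filter.atTop (nhds 0) :=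
    tendsto_inv_atTop_zero.comp (Filter.tendsto_atTop_add_const_right _ (-1) Filter.tendsto_id)
  refine tendsto_of_tendsto_of_tendsto_of_le_of_le' tendsto_const_nhds hlim ?_ ?_
  · filter_upwards [Filter.eventually_gt_atTop 0] with a ha
    exact sub_nonneg.mpr (Real.deriv_log_Gamma_le_log ha)
  · filter_upwards [Filter.eventually_gt_atTop 1] with a ha
    have ha₀ : 0 < a := by linarith
    have ha₁ : 0 < a - 1 := by linarith
    have hψ := Real.log_le_deriv_log_Gamma_add_one ha₁
    rw [sub_add_cancel] at hψ
    have hlog := Real.log_le_sub_one_of_pos (div_pos ha₀ ha₁)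
    rw [Real.log_div ha₀.ne' ha₁.ne'] at hlog
    have hdiv : a / (a - 1) - 1 = (a - 1)⁻¹ := by
      field_simp
      ring
    linarith
end

section
/- Let n ∈ ℕ, a₀, b₀ > 0, and T ≥ 0. Then there exists a > 0 such that n·(log(a) − ψ(a)) + a₀/a − b₀ − T = 0, where ψ(a) = d/da log Γ(a) is the digamma function. Consequently, with L(a) = n·a·log(a) − n·log Γ(a) − (T+n)·a + (a₀−1)·log(a) − b₀·a, there exists a > 0 with L′(a) + 1/a = 0. -/
open Set

theorem Real.differentiableAt_log_Gamma_s8 {a : ℝ} (ha : 0 < a) :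
    DifferentiableAt ℝ (fun x : ℝ => Real.log (Real.Gamma x)) a :=
  (Real.differentiableOn_Gamma_Ioi.differentiableAt (Ioi_mem_nhds ha)).log
    (Real.Gamma_pos_of_pos ha).ne'

theorem Real.log_Gamma_add_one {a : ℝ} (ha : 0 < a) :
    Real.log (Real.Gamma (a + 1)) = Real.log a + Real.log (Real.Gamma a) := by
  rw [Real.Gamma_add_one ha.ne', Real.log_mul ha.ne' (Real.Gamma_pos_of_pos ha).ne']

theorem Real.deriv_log_Gamma_le_log_s8 {a : ℝ} (ha : 0 < a) :
    deriv (fun x : ℝ => Real.log (Real.Gamma x)) a ≤ Real.log a := by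
  have h := Real.convexOn_log_Gamma.deriv_le_slope (x := a) (y := a + 1) ha
    (mem_Ioi.2 (by linarith)) (by linarith) (Real.differentiableAt_log_Gamma_s8 ha)
  rw [slope_def_field] at h
  simpa [Function.comp_def, Real.log_Gamma_add_one ha] using h

theorem Real.log_le_deriv_log_Gamma_add_one_s8 {a : ℝ} (ha : 0 < a) :
    Real.log a ≤ deriv (fun x : ℝ => Real.log (Real.Gamma x)) (a + 1) := by
  have h := Real.convexOn_log_Gamma.slope_le_deriv (x := a) (y := a + 1) ha
    (mem_Ioi.2 (by linarith)) (by linarith) (Real.differentiableAt_log_Gamma_s8 (by linarith))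
  rw [slope_def_field] at h
  simpa [Function.comp_def, Real.log_Gamma_add_one ha] using h

/-- The derivative of the log full conditional of the gamma shape parameter. -/
theorem hasDerivAt_gamma_shape (n : ℕ) (a0 b0 T : ℝ) {a : ℝ} (ha : 0 < a) :
    HasDerivAt (fun a : ℝ => n * a * Real.log a - n * Real.log (Real.Gamma a)
        - (T + n) * a + (a0 - 1) * Real.log a - b0 * a)
      (n * (Real.log a - deriv (fun x : ℝ => Real.log (Real.Gamma x)) a)
        + a0 / a - b0 - T - 1 / a) a := by
  have hlog := Real.hasDerivAt_log ha.ne'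
  have hid := hasDerivAt_id' a
  have h := (((((hid.const_mul (n : ℝ)).mul hlog).sub
    ((Real.differentiableAt_log_Gamma_s8 ha).hasDerivAt.const_mul (n : ℝ))).sub
    (hid.const_mul (T + n))).add (hlog.const_mul (a0 - 1))).sub (hid.const_mul b0)
  refine h.congr_deriv ?_
  field_simp
  ring

theorem gamma_shape_score_pos (n : ℕ) {a0 b0 T a : ℝ} (ha : 0 < a) (h : b0 + T < a0 / a) :
    0 < n * (Real.log a - deriv (fun x : ℝ => Real.log (Real.Gamma x)) a)
        + a0 / a - b0 - T := by
  have := mul_nonneg (Nat.cast_nonneg (α := ℝ) n)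
    (sub_nonneg.2 (Real.deriv_log_Gamma_le_log_s8 ha))
  linarith

theorem gamma_shape_score_add_one_neg (n : ℕ) {a0 b0 T a : ℝ} (ha0 : 0 ≤ a0) (ha : 0 < a)
    (h : (n + a0) / a < b0 + T) :
    n * (Real.log (a + 1) - deriv (fun x : ℝ => Real.log (Real.Gamma x)) (a + 1))
        + a0 / (a + 1) - b0 - T < 0 := by
  have hlog : Real.log (a + 1) - Real.log a ≤ 1 / a := by
    rw [← Real.log_div (by linarith) ha.ne']
    refine (Real.log_le_sub_one_of_pos (by positivity)).trans_eq ?_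
    field_simp
    ring
  have hn := mul_le_mul_of_nonneg_left
    ((sub_le_sub_left (Real.log_le_deriv_log_Gamma_add_one_s8 ha) (Real.log (a + 1))).trans hlog)
    (Nat.cast_nonneg (α := ℝ) n)
  have ha0' : a0 / (a + 1) ≤ a0 / a := by gcongr; linarith
  rw [add_div] at h
  rw [mul_one_div] at hn
  linarith

/-- For n ∈ ℕ, a₀, b₀ > 0, T ≥ 0, there exists a > 0 with
    n·(log a − ψ(a)) + a₀/a − b₀ − T = 0, and consequently, with
    L(a) = n·a·log a − n·log Γ(a) − (T+n)·a + (a₀−1)·log a − b₀·a,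
    L′(a) + 1/a = 0 at that point. -/
theorem gamma_shape_exists_root (n : ℕ) (a0 b0 : ℝ) (ha0 : 0 < a0) (hb0 : 0 < b0)
    (T : ℝ) (hT : 0 ≤ T) :
    ∃ a : ℝ, 0 < a ∧
      n * (Real.log a - deriv (fun x : ℝ => Real.log (Real.Gamma x)) a)
        + a0 / a - b0 - T = 0 ∧
      deriv (fun a : ℝ => n * a * Real.log a - n * Real.log (Real.Gamma a)
        - (T + n) * a + (a0 - 1) * Real.log a - b0 * a) a + 1 / a = 0 := by
  have hbT : 0 < b0 + T := by linarith
  have hl : 0 < a0 / (2 * (b0 + T)) := by positivity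
  have hr : 0 < 2 * (n + a0) / (b0 + T) := by positivity
  have hconv := (ordConnected_Ioi (a := (0 : ℝ))).image_hasDerivWithinAt
    (fun a ha => (((hasDerivAt_gamma_shape n a0 b0 T ha).add
      (Real.hasDerivAt_log (ne_of_gt ha))).hasDerivWithinAt))
  obtain ⟨a, ha, h⟩ := hconv.out
    (mem_image_of_mem _ (mem_Ioi.2 (add_pos hr one_pos))) (mem_image_of_mem _ (mem_Ioi.2 hl))
    (show (0 : ℝ) ∈ _ from ⟨by
      have := gamma_shape_score_add_one_neg n (T := T) (b0 := b0) ha0.le hr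
        (by field_simp; linarith)
      rw [← one_div]; linarith, by
      have := gamma_shape_score_pos n (T := T) (b0 := b0) (a0 := a0) hl
        (by field_simp; linarith)
      rw [← one_div]; linarith⟩)
  beta_reduce at h
  rw [← one_div, sub_add_cancel] at h
  refine ⟨a, ha, h, ?_⟩
  rw [(hasDerivAt_gamma_shape n a0 b0 T ha).deriv, sub_add_cancel, h]
end
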